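/- arXiv:2409.08686 — 2 statements merged into one kernel-verified Lean document; each statement's English description precedes it below -/
import Mathlib

section
/- Let A = kQ/I be a gentle algebra with a full-relational oriented cycle 𝒞 = a_1⋯a_l. If a_tA·ε_{𝒞,t} ≠ 0 for some 1 ≤ t ≤ l, then the underlying graph of Q contains at least two cycles. -/
/- Common infrastructure: finite quivers, path algebras, gentle algebras,
   right modules, Gorenstein projective modules, etc. -/

open MulOpposite

noncomputable section

/-- A finite quiver, with `nV` vertices and `nE` arrows. -/
structure QuiverData where
  nV : ℕ
  nE : ℕ
  src : Fin nE → Fin nV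
  tgt : Fin nE → Fin nV

/-- The relations defining the path algebra `kQ` as a quotient of the free
algebra on the set of vertices and arrows:  the trivial paths `e_v` are
orthogonal idempotents summing to `1`, and `e_{s(a)} * a = a = a * e_{t(a)}`.
(Paths are composed left-to-right, matching the paper's convention.) -/
inductive PathRel (k : Type) [Field k] (Q : QuiverData) :
    FreeAlgebra k (Fin Q.nV ⊕ Fin Q.nE) → FreeAlgebra k (Fin Q.nV ⊕ Fin Q.nE) → Prop
  | vtx_mul (v w : Fin Q.nV) : PathRel k Q
      (FreeAlgebra.ι k (Sum.inl v) * FreeAlgebra.ι k (Sum.inl w))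
      (if v = w then FreeAlgebra.ι k (Sum.inl v) else 0)
  | vtx_sum : PathRel k Q (∑ v : Fin Q.nV, FreeAlgebra.ι k (Sum.inl v)) 1
  | src_arr (e : Fin Q.nE) : PathRel k Q
      (FreeAlgebra.ι k (Sum.inl (Q.src e)) * FreeAlgebra.ι k (Sum.inr e))
      (FreeAlgebra.ι k (Sum.inr e))
  | arr_tgt (e : Fin Q.nE) : PathRel k Q
      (FreeAlgebra.ι k (Sum.inr e) * FreeAlgebra.ι k (Sum.inl (Q.tgt e)))
      (FreeAlgebra.ι k (Sum.inr e))

/-- The path algebra `kQ`. -/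
def PathAlg (k : Type) [Field k] (Q : QuiverData) := RingQuot (PathRel k Q)

instance (k : Type) [Field k] (Q : QuiverData) : Ring (PathAlg k Q) :=
  inferInstanceAs (Ring (RingQuot (PathRel k Q)))

instance (k : Type) [Field k] (Q : QuiverData) : Algebra k (PathAlg k Q) :=
  inferInstanceAs (Algebra k (RingQuot (PathRel k Q)))

/-- The arrow `e`, as an element of the path algebra. -/
def arr (k : Type) [Field k] (Q : QuiverData) (e : Fin Q.nE) : PathAlg k Q :=
  RingQuot.mkAlgHom k (PathRel k Q) (FreeAlgebra.ι k (Sum.inr e))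

/-- The trivial path (idempotent) at the vertex `v`, in the path algebra. -/
def vtx (k : Type) [Field k] (Q : QuiverData) (v : Fin Q.nV) : PathAlg k Q :=
  RingQuot.mkAlgHom k (PathRel k Q) (FreeAlgebra.ι k (Sum.inl v))

/-- Given a set `Rel` of (composable) pairs of arrows, the relation on `kQ`
identifying each corresponding length-two path with `0`; the quotient is
`kQ/I` where `I` is the two-sided ideal generated by these paths of length two. -/
def GRel (k : Type) [Field k] (Q : QuiverData) (Rel : Set (Fin Q.nE × Fin Q.nE)) :
    PathAlg k Q → PathAlg k Q → Prop := fun x y =>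
  (∃ p ∈ Rel, x = arr k Q p.1 * arr k Q p.2) ∧ y = 0

/-- The algebra `A = kQ/I`. -/
def GAlg (k : Type) [Field k] (Q : QuiverData) (Rel : Set (Fin Q.nE × Fin Q.nE)) :=
  RingQuot (GRel k Q Rel)

instance (k : Type) [Field k] (Q : QuiverData) (Rel : Set (Fin Q.nE × Fin Q.nE)) :
    Ring (GAlg k Q Rel) := inferInstanceAs (Ring (RingQuot (GRel k Q Rel)))

instance (k : Type) [Field k] (Q : QuiverData) (Rel : Set (Fin Q.nE × Fin Q.nE)) :
    Algebra k (GAlg k Q Rel) := inferInstanceAs (Algebra k (RingQuot (GRel k Q Rel)))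

/-- The canonical projection `kQ → kQ/I`. -/
def gmap (k : Type) [Field k] (Q : QuiverData) (Rel : Set (Fin Q.nE × Fin Q.nE)) :
    PathAlg k Q →ₐ[k] GAlg k Q Rel := RingQuot.mkAlgHom k (GRel k Q Rel)

/-- Membership in the ideal `I` (the kernel of `kQ → kQ/I`). -/
def inI (k : Type) [Field k] (Q : QuiverData) (Rel : Set (Fin Q.nE × Fin Q.nE))
    (x : PathAlg k Q) : Prop := gmap k Q Rel x = 0

/-- The idempotent `ε_v ∈ A` at a vertex `v`. -/
def vtxA (k : Type) [Field k] (Q : QuiverData) (Rel : Set (Fin Q.nE × Fin Q.nE))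
    (v : Fin Q.nV) : GAlg k Q Rel := gmap k Q Rel (vtx k Q v)

/-- The image in `A` of an arrow `e`. -/
def arrA (k : Type) [Field k] (Q : QuiverData) (Rel : Set (Fin Q.nE × Fin Q.nE))
    (e : Fin Q.nE) : GAlg k Q Rel := gmap k Q Rel (arr k Q e)

/-- `(Q, I)` is a gentle pair (with `I` the ideal generated by the length-two
paths coming from `Rel`), and moreover `I` is admissible. -/
structure IsGentle (k : Type) [Field k] (Q : QuiverData)
    (Rel : Set (Fin Q.nE × Fin Q.nE)) : Prop where
  /-- the generating relations are composable length-two paths -/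
  comp_rel : ∀ p ∈ Rel, Q.tgt p.1 = Q.src p.2
  /-- every vertex is the source of at most two arrows -/
  src_card : ∀ v, (Finset.univ.filter fun e => Q.src e = v).card ≤ 2
  /-- every vertex is the target of at most two arrows -/
  tgt_card : ∀ v, (Finset.univ.filter fun e => Q.tgt e = v).card ≤ 2
  /-- for each arrow `a` there is at most one arrow `b` with `ab ∉ I` -/
  uniq_nonrel_right : ∀ a b c, ¬ inI k Q Rel (arr k Q a * arr k Q b) →
    ¬ inI k Q Rel (arr k Q a * arr k Q c) → b = c
  /-- for each arrow `a` there is at most one arrow `c` with `ca ∉ I` -/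
  uniq_nonrel_left : ∀ a b c, ¬ inI k Q Rel (arr k Q b * arr k Q a) →
    ¬ inI k Q Rel (arr k Q c * arr k Q a) → b = c
  /-- for each arrow `a` there is at most one (composable) arrow `b` with `ab ∈ I` -/
  uniq_rel_right : ∀ a b c, Q.tgt a = Q.src b → Q.tgt a = Q.src c →
    inI k Q Rel (arr k Q a * arr k Q b) → inI k Q Rel (arr k Q a * arr k Q c) → b = c
  /-- for each arrow `a` there is at most one (composable) arrow `c` with `ca ∈ I` -/
  uniq_rel_left : ∀ a b c, Q.tgt b = Q.src a → Q.tgt c = Q.src a →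
    inI k Q Rel (arr k Q b * arr k Q a) → inI k Q Rel (arr k Q c * arr k Q a) → b = c
  /-- admissibility: some power of the arrow ideal is contained in `I` -/
  admissible : ∃ m, 2 ≤ m ∧ ∀ f : Fin m → Fin Q.nE,
    inI k Q Rel (List.ofFn fun i => arr k Q (f i)).prod

/-- A full-relational oriented cycle `𝒞 = a_1 ⋯ a_len` (of length ≥ 3, as assumed
throughout the paper) in the bound quiver `(Q, I)`, encoded by a periodic
sequence of arrows.  `arrows i` is the arrow `a_{i+1}` (`0`-indexed),
consecutive arrows are composable, all consecutive length-two paths lie in `I`,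
and the vertices of the cycle are pairwise distinct. -/
structure FRCycle (k : Type) [Field k] (Q : QuiverData)
    (Rel : Set (Fin Q.nE × Fin Q.nE)) where
  len : ℕ
  len3 : 3 ≤ len
  arrows : ℕ → Fin Q.nE
  periodic : ∀ i, arrows (i + len) = arrows i
  comp : ∀ i, Q.tgt (arrows i) = Q.src (arrows (i + 1))
  frel : ∀ i, inI k Q Rel (arr k Q (arrows i) * arr k Q (arrows (i + 1)))
  vinj : ∀ i j, i < len → j < len → Q.src (arrows i) = Q.src (arrows j) → i = j

/-- There are no full-relational oriented cycles of length `< 3` (the blanket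
assumption of the paper). -/
def NoShortFRC (k : Type) [Field k] (Q : QuiverData)
    (Rel : Set (Fin Q.nE × Fin Q.nE)) : Prop :=
  ∀ (l : ℕ) (c : ℕ → Fin Q.nE), 1 ≤ l → (∀ i, c (i + l) = c i) →
    (∀ i, Q.tgt (c i) = Q.src (c (i + 1))) →
    (∀ i, inI k Q Rel (arr k Q (c i) * arr k Q (c (i + 1)))) → 3 ≤ l

/-- The set of arrows lying on the cycle. -/
def FRCycle.arrowSet {k : Type} [Field k] {Q : QuiverData}
    {Rel : Set (Fin Q.nE × Fin Q.nE)} (C : FRCycle k Q Rel) : Set (Fin Q.nE) :=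
  {a | ∃ i < C.len, C.arrows i = a}

/-- The idempotent `ε_{𝒞,t} ∈ A`: the sum of the `ε_v` over the vertices `v`
of the cycle `𝒞` other than `s(a_t)` and `t(a_t)`. -/
def epsCt (k : Type) [Field k] (Q : QuiverData) (Rel : Set (Fin Q.nE × Fin Q.nE))
    (C : FRCycle k Q Rel) (t : ℕ) : GAlg k Q Rel :=
  ∑ i ∈ (Finset.range C.len).filter
      (fun i => Q.src (C.arrows i) ≠ Q.src (C.arrows t) ∧
        Q.src (C.arrows i) ≠ Q.tgt (C.arrows t)),
    vtxA k Q Rel (Q.src (C.arrows i))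

/-- The relation identifying an element `ε` of a ring with `0`; the quotient is
`R/RεR`. -/
def QuotRel (R : Type) [Ring R] (ε : R) : R → R → Prop := fun x y => x = ε ∧ y = 0

/-- The quotient ring `R/RεR`. -/
def QuotBy (R : Type) [Ring R] (ε : R) := RingQuot (QuotRel R ε)

instance (R : Type) [Ring R] (ε : R) : Ring (QuotBy R ε) :=
  inferInstanceAs (Ring (RingQuot (QuotRel R ε)))

/-- The canonical projection `R → R/RεR`. -/
def qmap (R : Type) [Ring R] (ε : R) : R →+* QuotBy R ε := RingQuot.mkRingHom (QuotRel R ε)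

/-- The right ideal `xR`, as a right `R`-module (i.e. an `Rᵐᵒᵖ`-submodule of `R`). -/
def rIdeal (R : Type) [Ring R] (x : R) : Submodule Rᵐᵒᵖ R := Submodule.span Rᵐᵒᵖ {x}

/-- Restriction of scalars along `π : R →+* S` turns a right `S`-module into a
right `R`-module. -/
def modRestrict {R S : Type} [Ring R] [Ring S] (π : R →+* S) (M : Type)
    [AddCommGroup M] [Module Sᵐᵒᵖ M] : Module Rᵐᵒᵖ M :=
  Module.compHom M (RingHom.op π)

/-- `M` is a Gorenstein projective right `R`-module:  there is a complete
resolution, i.e. an exact sequence `⋯ → P⁻² → P⁻¹ → P⁰ → P¹ → ⋯` of finitely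
generated projective right `R`-modules which stays exact after applying
`Hom_R(-, R)`, with `M ≅ Im(P⁻¹ → P⁰)`. -/
def IsGProjMod (R : Type) [Ring R] (M : Type) [AddCommGroup M] [Module Rᵐᵒᵖ M] : Prop :=
  ∃ (P : ℤ → ModuleCat.{0} Rᵐᵒᵖ) (d : (n : ℤ) → (P n →ₗ[Rᵐᵒᵖ] P (n + 1))),
    (∀ n, Module.Finite Rᵐᵒᵖ (P n)) ∧
    (∀ n, Module.Projective Rᵐᵒᵖ (P n)) ∧
    (∀ n, LinearMap.range (d n) = LinearMap.ker (d (n + 1))) ∧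
    (∀ (n : ℤ) (g : P (n + 1) →ₗ[Rᵐᵒᵖ] R),
      g.comp (d n) = 0 ↔ ∃ h : P (n + 1 + 1) →ₗ[Rᵐᵒᵖ] R, h.comp (d (n + 1)) = g) ∧
    Nonempty (M ≃ₗ[Rᵐᵒᵖ] LinearMap.range (d (-1)))

/-- `M` is an indecomposable `S`-module. -/
def IsIndec (S : Type) [Ring S] (M : Type) [AddCommGroup M] [Module S M] : Prop :=
  Nontrivial M ∧ ∀ N₁ N₂ : Submodule S M, IsCompl N₁ N₂ → N₁ = ⊥ ∨ N₂ = ⊥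

/-- `M` is a non-projective indecomposable Gorenstein projective right `R`-module. -/
def IsNPIGProj (R : Type) [Ring R] (M : Type) [AddCommGroup M] [Module Rᵐᵒᵖ M] : Prop :=
  IsGProjMod R M ∧ IsIndec Rᵐᵒᵖ M ∧ ¬ Module.Projective Rᵐᵒᵖ M

/-- A right `S`-module `M`, viewed as a right `R`-module along `π : R →+* S`, is a
non-projective indecomposable Gorenstein projective right `R`-module. -/
def RestrIsNPIGProj {R S : Type} [Ring R] [Ring S] (π : R →+* S) (M : Type)
    [AddCommGroup M] [Module Sᵐᵒᵖ M] : Prop :=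
  letI := modRestrict π M
  IsNPIGProj R M

/-- The submodule `M·(RεR)` of a right `R`-module `M`;  the quotient
`M ⧸ M·(RεR)` realizes the tensor product `M ⊗_R R/RεR`. -/
def smulIdeal (R : Type) [Ring R] (ε : R) (M : Type) [AddCommGroup M]
    [Module Rᵐᵒᵖ M] : Submodule Rᵐᵒᵖ M :=
  Submodule.span Rᵐᵒᵖ {m | ∃ (x : M) (a b : R), m = (op (a * ε * b)) • x}

/-- `S` has finitely many finitely generated indecomposable modules up to
isomorphism.  (Applied with `S = Aᵐᵒᵖ` this says `A` is representation-finite.) -/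
def RepFinite (S : Type) [Ring S] : Prop :=
  ∃ (n : ℕ) (M : Fin n → ModuleCat.{0} S), ∀ N : ModuleCat.{0} S,
    Module.Finite S N → IsIndec S N → ∃ i, Nonempty (N ≃ₗ[S] M i)

/-- A cycle in the underlying undirected graph of `Q`:  a closed walk of
length ≥ 1 along edges (each traversed forwards or backwards) with pairwise
distinct vertices and pairwise distinct edges. -/
structure UCycle (Q : QuiverData) where
  len : ℕ
  len1 : 1 ≤ len
  edges : ℕ → Fin Q.nE
  dir : ℕ → Bool
  vert : ℕ → Fin Q.nV
  pe : ∀ i, edges (i + len) = edges i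
  pd : ∀ i, dir (i + len) = dir i
  pv : ∀ i, vert (i + len) = vert i
  incid_t : ∀ i, dir i = true →
    Q.src (edges i) = vert i ∧ Q.tgt (edges i) = vert (i + 1)
  incid_f : ∀ i, dir i = false →
    Q.tgt (edges i) = vert i ∧ Q.src (edges i) = vert (i + 1)
  vdist : ∀ i j, i < len → j < len → vert i = vert j → i = j
  edist : ∀ i j, i < len → j < len → edges i = edges j → i = j

/-- The set of edges of an undirected cycle. -/
def UCycle.edgeSet {Q : QuiverData} (C : UCycle Q) : Set (Fin Q.nE) :=
  {e | ∃ i < C.len, C.edges i = e}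

/-- The underlying graph of `Q` has exactly one cycle. -/
def OneCycle (Q : QuiverData) : Prop :=
  Nonempty (UCycle Q) ∧ ∀ C C' : UCycle Q, C.edgeSet = C'.edgeSet

/-- The projective dimension of (the module underlying) `M` is at most `n`. -/
def projDimLE (S : Type) [Ring S] : ℕ → ModuleCat.{0} S → Prop
  | 0, M => Module.Projective S M
  | n + 1, M => ∃ (P : ModuleCat.{0} S) (f : P →ₗ[S] M), Module.Projective S P ∧
      Function.Surjective f ∧ projDimLE S n (ModuleCat.of S (LinearMap.ker f))

/-- The injective dimension of (the module underlying) `M` is at most `n`. -/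
def injDimLE (S : Type) [Ring S] : ℕ → ModuleCat.{0} S → Prop
  | 0, M => Module.Injective S M
  | n + 1, M => ∃ (J : ModuleCat.{0} S) (f : M →ₗ[S] J), Module.Injective S J ∧
      Function.Injective f ∧ injDimLE S n (ModuleCat.of S (J ⧸ LinearMap.range f))

end

/-- There is an arrow of `Q` from `u` to `v`. -/
def QuiverData.Step (Q : QuiverData) (u v : Fin Q.nV) : Prop :=
  ∃ e, Q.src e = u ∧ Q.tgt e = v

/-- A closed directed walk with `n + 1` arrows, given by the first `n + 1` values of `f`. -/
def QuiverData.IsClosedWalk (Q : QuiverData) (n : ℕ) (f : ℕ → Fin Q.nE) : Prop :=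
  (∀ i < n, Q.tgt (f i) = Q.src (f (i + 1))) ∧ Q.tgt (f n) = Q.src (f 0)

theorem QuiverData.exists_walk_of_reachable (Q : QuiverData) (b : Fin Q.nE) {v : Fin Q.nV}
    (h : Relation.ReflTransGen Q.Step (Q.tgt b) v) :
    ∃ (n : ℕ) (f : ℕ → Fin Q.nE), f 0 = b ∧
      (∀ i < n, Q.tgt (f i) = Q.src (f (i + 1))) ∧ Q.tgt (f n) = v := by
  induction h with
  | refl => exact ⟨0, fun _ => b, rfl, by simp, rfl⟩
  | tail _ hstep ih =>
    obtain ⟨e, hs, ht⟩ := hstep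
    obtain ⟨n, f, h0, hf, hn⟩ := ih
    refine ⟨n + 1, fun i => if i ≤ n then f i else e, by simp [h0], fun i hi => ?_, by simp [ht]⟩
    rcases Nat.lt_succ_iff_lt_or_eq.mp hi with h | rfl
    · simp [show i ≤ n by omega, show i + 1 ≤ n by omega, hf i h]
    · simp [hn, hs]

/-- A closed directed walk repeating a vertex can be shortened without changing its first arrow. -/
theorem QuiverData.IsClosedWalk.shorten {Q : QuiverData} {n : ℕ} {f : ℕ → Fin Q.nE}
    (hf : Q.IsClosedWalk n f) {i j : ℕ} (hij : i < j) (hj : j ≤ n)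
    (h : Q.src (f i) = Q.src (f j)) :
    ∃ m < n, ∃ g, g 0 = f 0 ∧ Q.IsClosedWalk m g := by
  obtain ⟨hc, hn⟩ := hf
  rcases Nat.eq_zero_or_pos i with rfl | hi
  · refine ⟨j - 1, by omega, f, rfl, fun a ha => hc a (by omega), ?_⟩
    rw [hc (j - 1) (by omega), Nat.sub_add_cancel hij, h]
  · refine ⟨n - (j - i), by omega, fun a => if a < i then f a else f (a + (j - i)),
      by simp [hi], fun a ha => ?_, ?_⟩
    · rcases lt_trichotomy (a + 1) i with h1 | h1 | h1
      · simp [h1, show a < i by omega, hc a (by omega)]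
      · subst h1
        simp [hc a (by omega), h, show a + 1 + (j - (a + 1)) = j by omega]
      · simp only [show ¬ a < i by omega, show ¬ a + 1 < i by omega, if_false]
        rw [hc _ (by omega), show a + (j - i) + 1 = a + 1 + (j - i) by omega]
    · simp [show ¬ n - (j - i) < i by omega, hi, show n - (j - i) + (j - i) = n by omega, hn]

/-- An arrow whose source is reachable from its target lies on a cycle. -/
theorem QuiverData.exists_uCycle_of_reachable (Q : QuiverData) (b : Fin Q.nE)
    (h : Relation.ReflTransGen Q.Step (Q.tgt b) (Q.src b)) :
    ∃ C : UCycle Q, b ∈ C.edgeSet := by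
  classical
  have hex : ∃ n f, f 0 = b ∧ Q.IsClosedWalk n f := by
    obtain ⟨n, f, h0, hf, hn⟩ := Q.exists_walk_of_reachable b h
    exact ⟨n, f, h0, hf, by rw [hn, h0]⟩
  obtain ⟨f, h0, hf⟩ := Nat.find_spec hex
  have hmin : ∀ m < Nat.find hex, ¬ ∃ g, g 0 = b ∧ Q.IsClosedWalk m g :=
    fun m hm => Nat.find_min hex hm
  generalize Nat.find hex = n at hf hmin
  have hinj : ∀ i j, i < n + 1 → j < n + 1 → Q.src (f i) = Q.src (f j) → i = j := by
    have key : ∀ i j, i < j → j < n + 1 → Q.src (f i) ≠ Q.src (f j) := fun i j hij hj he => by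
      obtain ⟨m, hm, g, hg0, hg⟩ := hf.shorten hij (by omega) he
      exact hmin m hm ⟨g, hg0.trans h0, hg⟩
    intro i j hi hj he
    rcases lt_trichotomy i j with h | h | h
    · exact absurd he (key i j h hj)
    · exact h
    · exact absurd he.symm (key j i h hi)
  refine ⟨{ len := n + 1
            len1 := by omega
            edges := fun i => f (i % (n + 1))
            dir := fun _ => true
            vert := fun i => Q.src (f (i % (n + 1)))
            pe := by simp
            pd := by simp
            pv := by simp
            incid_t := fun i _ => ⟨rfl, ?_⟩
            incid_f := by simp
            vdist := fun i j hi hj he => ?_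
            edist := fun i j hi hj he => ?_ }, 0, by simp, by simpa using h0⟩
  · have hlt : i % (n + 1) < n + 1 := Nat.mod_lt i (Nat.succ_pos n)
    rcases Nat.lt_succ_iff_lt_or_eq.mp hlt with h | h
    · rw [hf.1 _ h, Nat.add_mod i 1, Nat.mod_eq_of_lt (a := 1) (by omega),
        Nat.mod_eq_of_lt (a := i % (n + 1) + 1) (by omega)]
    · have : (i + 1) % (n + 1) = 0 := by
        rw [← Nat.mod_add_mod, h, Nat.mod_self]
      rw [this]
      simpa [h] using hf.2
  · rw [Nat.mod_eq_of_lt hi, Nat.mod_eq_of_lt hj] at he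
    exact hinj i j hi hj he
  · rw [Nat.mod_eq_of_lt hi, Nat.mod_eq_of_lt hj] at he
    exact hinj i j hi hj (by rw [he])

namespace FRCycle

variable {k : Type} [Field k] {Q : QuiverData} {Rel : Set (Fin Q.nE × Fin Q.nE)}

/-- A full-relational oriented cycle, as a cycle of the underlying graph. -/
def toUCycle (C : FRCycle k Q Rel) : UCycle Q where
  len := C.len
  len1 := by have := C.len3; omega
  edges := C.arrows
  dir := fun _ => true
  vert := fun i => Q.src (C.arrows i)
  pe := C.periodic
  pd := by simp
  pv := fun i => by rw [C.periodic]
  incid_t := fun i _ => ⟨rfl, C.comp i⟩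
  incid_f := by simp
  vdist := C.vinj
  edist := fun i j hi hj h => C.vinj i j hi hj (by rw [h])

theorem toUCycle_edgeSet (C : FRCycle k Q Rel) : C.toUCycle.edgeSet = C.arrowSet := rfl

theorem reachable (C : FRCycle k Q Rel) (i j : ℕ) :
    Relation.ReflTransGen Q.Step (Q.src (C.arrows i)) (Q.src (C.arrows j)) := by
  have forward : ∀ n, Relation.ReflTransGen Q.Step (Q.src (C.arrows i))
      (Q.src (C.arrows (i + n))) := fun n => by
    induction n with
    | zero => exact .refl
    | succ n ih => exact ih.tail ⟨_, rfl, C.comp _⟩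
  have hle : i ≤ j + i * C.len :=
    (Nat.le_mul_of_pos_right i (by have := C.len3; omega)).trans (Nat.le_add_left _ _)
  have := forward (j + i * C.len - i)
  have hp := (show Function.Periodic C.arrows C.len from C.periodic).nat_mul i j
  rw [Nat.cast_id] at hp
  rwa [Nat.add_sub_cancel' hle, hp] at this

theorem eq_of_mem_arrowSet (C : FRCycle k Q Rel) {t : ℕ} {b : Fin Q.nE} (hb : b ∈ C.arrowSet)
    (h : Q.src b = Q.tgt (C.arrows t)) : b = C.arrows (t + 1) := by
  obtain ⟨i, hi, rfl⟩ := hb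
  have hp := (show Function.Periodic C.arrows C.len from C.periodic).map_mod_nat (t + 1)
  rw [C.comp, ← hp] at h
  rw [C.vinj i _ hi (Nat.mod_lt _ (by omega)) h, hp]

end FRCycle

section GAlg

variable (k : Type) [Field k] (Q : QuiverData) (Rel : Set (Fin Q.nE × Fin Q.nE))

theorem vtxA_mul_vtxA (v w : Fin Q.nV) :
    vtxA k Q Rel v * vtxA k Q Rel w = if v = w then vtxA k Q Rel v else 0 := by
  have h : vtx k Q v * vtx k Q w = if v = w then vtx k Q v else 0 := by
    have := RingQuot.mkAlgHom_rel k (PathRel.vtx_mul (k := k) (Q := Q) v w)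
    rw [map_mul, apply_ite (RingQuot.mkAlgHom k (PathRel k Q)), map_zero] at this
    exact this
  unfold vtxA
  rw [← map_mul, h, apply_ite (gmap k Q Rel), map_zero]

theorem vtxA_src_mul_arrA (e : Fin Q.nE) :
    vtxA k Q Rel (Q.src e) * arrA k Q Rel e = arrA k Q Rel e := by
  have h : vtx k Q (Q.src e) * arr k Q e = arr k Q e := by
    have := RingQuot.mkAlgHom_rel k (PathRel.src_arr (k := k) (Q := Q) e)
    rw [map_mul] at this
    exact this
  unfold vtxA arrA
  rw [← map_mul, h]

theorem arrA_mul_vtxA_tgt (e : Fin Q.nE) :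
    arrA k Q Rel e * vtxA k Q Rel (Q.tgt e) = arrA k Q Rel e := by
  have h : arr k Q e * vtx k Q (Q.tgt e) = arr k Q e := by
    have := RingQuot.mkAlgHom_rel k (PathRel.arr_tgt (k := k) (Q := Q) e)
    rw [map_mul] at this
    exact this
  unfold vtxA arrA
  rw [← map_mul, h]

variable {k Q Rel}

theorem mul_arrA_eq_zero {y : GAlg k Q Rel} {v : Fin Q.nV} (hy : y * vtxA k Q Rel v = y)
    {e : Fin Q.nE} (he : Q.src e ≠ v) : y * arrA k Q Rel e = 0 := by
  rw [← hy, ← vtxA_src_mul_arrA, mul_assoc, ← mul_assoc (vtxA k Q Rel v), vtxA_mul_vtxA,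
    if_neg he.symm, zero_mul, mul_zero]

theorem mul_vtxA_eq_ite {y : GAlg k Q Rel} {v : Fin Q.nV} (hy : y * vtxA k Q Rel v = y)
    (w : Fin Q.nV) : y * vtxA k Q Rel w = if v = w then y else 0 := by
  rw [← hy, mul_assoc, vtxA_mul_vtxA, mul_ite, mul_zero]

theorem mul_epsCt_eq_zero {y : GAlg k Q Rel} {v : Fin Q.nV} (hy : y * vtxA k Q Rel v = y)
    (C : FRCycle k Q Rel) (t : ℕ)
    (hv : v = Q.tgt (C.arrows t) ∨ ∀ i, Q.src (C.arrows i) ≠ v) :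
    y * epsCt k Q Rel C t = 0 := by
  rw [epsCt, Finset.mul_sum]
  refine Finset.sum_eq_zero fun i hi => ?_
  rw [mul_vtxA_eq_ite hy, if_neg]
  rintro rfl
  rcases hv with hv | hv
  · exact (Finset.mem_filter.mp hi).2.2 hv
  · exact hv i rfl

/-- A subspace of `A` stable under right multiplication by trivial paths and arrows is a
right ideal. -/
theorem mul_mem_of_generators (N : Submodule k (GAlg k Q Rel))
    (hv : ∀ v, ∀ y ∈ N, y * vtxA k Q Rel v ∈ N) (he : ∀ e, ∀ y ∈ N, y * arrA k Q Rel e ∈ N)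
    (x : GAlg k Q Rel) : ∀ y ∈ N, y * x ∈ N := by
  obtain ⟨φ, hφ, hφv, hφe⟩ : ∃ φ : FreeAlgebra k (Fin Q.nV ⊕ Fin Q.nE) →ₐ[k] GAlg k Q Rel,
      Function.Surjective φ ∧ (∀ v, φ (FreeAlgebra.ι k (Sum.inl v)) = vtxA k Q Rel v) ∧
      ∀ e, φ (FreeAlgebra.ι k (Sum.inr e)) = arrA k Q Rel e :=
    ⟨(gmap k Q Rel).comp (RingQuot.mkAlgHom k (PathRel k Q) : _ →ₐ[k] PathAlg k Q),
      (RingQuot.mkAlgHom_surjective k (GRel k Q Rel)).comp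
        (RingQuot.mkAlgHom_surjective k (PathRel k Q)), fun _ => rfl, fun _ => rfl⟩
  obtain ⟨x, rfl⟩ := hφ x
  induction x using FreeAlgebra.induction with
  | grade0 r =>
    intro y hy
    rw [AlgHom.commutes, ← Algebra.commutes, ← Algebra.smul_def]
    exact N.smul_mem r hy
  | grade1 s =>
    rcases s with v | e
    · rw [hφv]
      exact hv v
    · rw [hφe]
      exact he e
  | mul a b ha hb =>
    intro y hy
    rw [map_mul, ← mul_assoc]
    exact hb _ (ha _ hy)
  | add a b ha hb =>
    intro y hy
    rw [map_add, mul_add]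
    exact N.add_mem (ha _ hy) (hb _ hy)

/-- If `a_t A ε_{𝒞,t} ≠ 0`, some path leaves `𝒞` at the target of `a_t` and returns to `𝒞`. -/
theorem exists_reachable_of_ne_zero (C : FRCycle k Q Rel) (t : ℕ)
    (hne : ∃ x : GAlg k Q Rel, arrA k Q Rel (C.arrows t) * x * epsCt k Q Rel C t ≠ 0) :
    ∃ b ∉ C.arrowSet, Q.src b = Q.tgt (C.arrows t) ∧
      ∃ i, Relation.ReflTransGen Q.Step (Q.tgt b) (Q.src (C.arrows i)) := by
  by_contra! hcon
  obtain ⟨x, hx⟩ := hne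
  let W : Set (Fin Q.nV) := {v | ∃ b ∉ C.arrowSet, Q.src b = Q.tgt (C.arrows t) ∧
    Relation.ReflTransGen Q.Step (Q.tgt b) v}
  let S : Set (GAlg k Q Rel) :=
    {y | y = arrA k Q Rel (C.arrows t) ∨ ∃ v ∈ W, y * vtxA k Q Rel v = y}
  let N := Submodule.span k S
  have extend : ∀ z : GAlg k Q Rel, (∀ y ∈ S, y * z ∈ N) → ∀ y ∈ N, y * z ∈ N := by
    intro z hz y hy
    induction hy using Submodule.span_induction with
    | mem y hy => exact hz y hy
    | zero => simp
    | add a b _ _ ha hb => rw [add_mul]; exact N.add_mem ha hb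
    | smul r a _ ha => rw [smul_mul_assoc]; exact N.smul_mem r ha
  have tgt_fix : ∀ (y : GAlg k Q Rel) e,
      y * arrA k Q Rel e * vtxA k Q Rel (Q.tgt e) = y * arrA k Q Rel e := fun y e => by
    rw [mul_assoc, arrA_mul_vtxA_tgt]
  have hN : arrA k Q Rel (C.arrows t) * x ∈ N := by
    refine mul_mem_of_generators N (fun v => extend _ fun y hy => ?_)
      (fun e => extend _ fun y hy => ?_) x _ (Submodule.subset_span (Or.inl rfl))
    · obtain ⟨w, hw⟩ : ∃ w, y * vtxA k Q Rel w = y := by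
        rcases hy with rfl | ⟨w, _, hw⟩
        · exact ⟨_, arrA_mul_vtxA_tgt k Q Rel _⟩
        · exact ⟨w, hw⟩
      rw [mul_vtxA_eq_ite hw]
      split_ifs
      · exact Submodule.subset_span hy
      · exact N.zero_mem
    · rcases hy with rfl | ⟨w, hwW, hw⟩
      · by_cases hs : Q.src e = Q.tgt (C.arrows t)
        · by_cases hC : e ∈ C.arrowSet
          · obtain rfl := C.eq_of_mem_arrowSet hC hs
            have h0 : arrA k Q Rel (C.arrows t) * arrA k Q Rel (C.arrows (t + 1)) = 0 := by
              have := C.frel t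
              rwa [inI, map_mul] at this
            rw [h0]
            exact N.zero_mem
          · exact Submodule.subset_span (Or.inr ⟨Q.tgt e, ⟨e, hC, hs, .refl⟩, tgt_fix _ e⟩)
        · rw [mul_arrA_eq_zero (arrA_mul_vtxA_tgt k Q Rel _) hs]
          exact N.zero_mem
      · by_cases hs : Q.src e = w
        · obtain ⟨b, hbC, hb, hr⟩ := hwW
          exact Submodule.subset_span
            (Or.inr ⟨Q.tgt e, ⟨b, hbC, hb, hr.tail ⟨e, hs, rfl⟩⟩, tgt_fix _ e⟩)
        · rw [mul_arrA_eq_zero hw hs]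
          exact N.zero_mem
  refine hx ?_
  generalize arrA k Q Rel (C.arrows t) * x = y at hN
  induction hN using Submodule.span_induction with
  | mem y hy =>
    rcases hy with rfl | ⟨v, ⟨b, hbC, hb, hr⟩, hv⟩
    · exact mul_epsCt_eq_zero (arrA_mul_vtxA_tgt k Q Rel _) C t (Or.inl rfl)
    · refine mul_epsCt_eq_zero hv C t (Or.inr ?_)
      rintro i rfl
      exact hcon b hbC hb i hr
  | zero => simp
  | add a b _ _ ha hb => rw [add_mul, ha, hb, add_zero]
  | smul r a _ ha => rw [smul_mul_assoc, ha, smul_zero]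

end GAlg

/-- Lemma `lemm:cycle` (1).  Let `A = kQ/I` be gentle with a
full-relational oriented cycle `𝒞 = a_1 ⋯ a_l`.  If `a_t A ε_{𝒞,t} ≠ 0` for some
`t < l`, then the underlying graph of `Q` contains at least two cycles. -/
theorem stmt5 (k : Type) [Field k] [IsAlgClosed k] (Q : QuiverData)
    (Rel : Set (Fin Q.nE × Fin Q.nE)) (hgentle : IsGentle k Q Rel)
    (hfd : Module.Finite k (GAlg k Q Rel)) (hns : NoShortFRC k Q Rel)
    (C : FRCycle k Q Rel) (t : ℕ) (ht : t < C.len)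
    (hne : ∃ x : GAlg k Q Rel,
      arrA k Q Rel (C.arrows t) * x * epsCt k Q Rel C t ≠ 0) :
    ∃ C₁ C₂ : UCycle Q, C₁.edgeSet ≠ C₂.edgeSet := by
  obtain ⟨b, hbC, hb, i, hr⟩ := exists_reachable_of_ne_zero C t hne
  have hback : Relation.ReflTransGen Q.Step (Q.tgt b) (Q.src b) := by
    rw [hb, C.comp]
    exact hr.trans (C.reachable i (t + 1))
  obtain ⟨C₂, hC₂⟩ := Q.exists_uCycle_of_reachable b hback
  refine ⟨C.toUCycle, C₂, fun h => hbC ?_⟩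
  rwa [← C.toUCycle_edgeSet, h]
end

section
/- Let A = kQ/I be a gentle algebra with a full-relational oriented cycle 𝒞 = a_1⋯a_l, where s(a_i) = i for 1 ≤ i ≤ l and indices are taken modulo l. If dim_k a_tAε_{t+2} > 1 for some 1 ≤ t ≤ l (ε_{t+2} being the trivial-path idempotent at the vertex t+2 = t(a_{t+1})), then A is representation-infinite. -/
/- Common infrastructure: finite quivers, path algebras, gentle algebras,
   right modules, Gorenstein projective modules, etc. -/

open MulOpposite

section Representations

/-- The action of the trivial path at `v` on sequences indexed by the positions of a walk that
visits the vertex `vert j` at position `j`. -/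
def vtxEnd (k : Type) [Field k] (Q : QuiverData) (vert : ℕ → Fin Q.nV) (v : Fin Q.nV) :
    Module.End k (ℕ → k) where
  toFun u j := if vert j = v then u j else 0
  map_add' u w := by
    funext j
    by_cases h : vert j = v <;> simp [h]
  map_smul' c u := by
    funext j
    by_cases h : vert j = v <;> simp [h]

/-- The action of the arrow `e`: it moves position `j` to `j + 1` when the `j`-th letter of the
path `p` of length `n` is `e`, and if `e = a` it moves position `0` to `n`, with weight `τ`. -/
def arrEnd (k : Type) [Field k] (Q : QuiverData) (n : ℕ) (p : ℕ → Fin Q.nE) (a : Fin Q.nE)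
    (τ : k) (e : Fin Q.nE) : Module.End k (ℕ → k) where
  toFun u
    | 0 => 0
    | j + 1 => (if j < n ∧ p j = e then u j else 0) + (if j + 1 = n ∧ e = a then τ * u 0 else 0)
  map_add' u w := by
    funext j
    cases j with
    | zero => simp
    | succ j =>
      simp only [Pi.add_apply]
      split_ifs <;> ring
  map_smul' c u := by
    funext j
    cases j with
    | zero => simp
    | succ j =>
      simp only [Pi.smul_apply, smul_eq_mul, RingHom.id_apply]
      split_ifs <;> ring

/-- The conditions under which the walk `p` of length `n` through the vertices `vert`, together
with the arrow `a` of weight `τ` from its start to its end, carries a representation of `(Q, I)`. -/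
structure IsBandDatum (k : Type) [Field k] (Q : QuiverData) (Rel : Set (Fin Q.nE × Fin Q.nE))
    (n : ℕ) (p : ℕ → Fin Q.nE) (vert : ℕ → Fin Q.nV) (a : Fin Q.nE) (τ : k) : Prop where
  src_eq : ∀ i < n, Q.src (p i) = vert i
  tgt_eq : ∀ i < n, Q.tgt (p i) = vert (i + 1)
  nonrel : ∀ i, i + 1 < n → (p i, p (i + 1)) ∉ Rel
  src_arrow : τ ≠ 0 → Q.src a = vert 0
  tgt_arrow : τ ≠ 0 → Q.tgt a = vert n

/-- The action of the free algebra underlying a representation of band type. -/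
def freeBandRep (k : Type) [Field k] (Q : QuiverData) (n : ℕ) (p : ℕ → Fin Q.nE)
    (vert : ℕ → Fin Q.nV) (a : Fin Q.nE) (τ : k) :
    FreeAlgebra k (Fin Q.nV ⊕ Fin Q.nE) →ₐ[k] (Module.End k (ℕ → k))ᵐᵒᵖ :=
  FreeAlgebra.lift k
    (Sum.elim (fun v => op (vtxEnd k Q vert v)) (fun e => op (arrEnd k Q n p a τ e)))

variable {k : Type} [Field k] {Q : QuiverData} {Rel : Set (Fin Q.nE × Fin Q.nE)}
  {n : ℕ} {p : ℕ → Fin Q.nE} {vert : ℕ → Fin Q.nV} {a : Fin Q.nE} {τ : k}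

theorem IsBandDatum.freeBandRep_eq (h : IsBandDatum k Q Rel n p vert a τ)
    ⦃x y : FreeAlgebra k (Fin Q.nV ⊕ Fin Q.nE)⦄ (hxy : PathRel k Q x y) :
    freeBandRep k Q n p vert a τ x = freeBandRep k Q n p vert a τ y := by
  apply unop_injective
  refine LinearMap.ext fun u => funext fun j => ?_
  cases hxy with
  | vtx_mul v w =>
    by_cases hvw : v = w
    · subst hvw
      by_cases hj : vert j = v <;> simp [freeBandRep, vtxEnd, hj]
    · simp only [freeBandRep, vtxEnd, map_mul, FreeAlgebra.lift_ι_apply, Sum.elim_inl, if_neg hvw,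
        map_zero, unop_mul, unop_op, unop_zero, Module.End.mul_apply, LinearMap.coe_mk,
        AddHom.coe_mk, LinearMap.zero_apply, Pi.zero_apply]
      split_ifs with h1 h2
      · exact absurd (h2.symm.trans h1) hvw
      · rfl
      · rfl
  | vtx_sum =>
    simp [freeBandRep, vtxEnd, LinearMap.sum_apply, Finset.unop_sum, Finset.sum_apply]
  | src_arr e =>
    cases j with
    | zero => simp [freeBandRep, arrEnd]
    | succ j =>
      simp only [freeBandRep, arrEnd, vtxEnd, map_mul, FreeAlgebra.lift_ι_apply, Sum.elim_inl,
        Sum.elim_inr, unop_mul, unop_op, Module.End.mul_apply, LinearMap.coe_mk, AddHom.coe_mk]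
      congr 1
      · split_ifs with h1 h2
        · rfl
        · exact absurd (by rw [← h.src_eq j h1.1, h1.2]) h2
        · rfl
      · by_cases hτ : τ = 0
        · simp [hτ]
        · split_ifs with h1 h2
          · rfl
          · exact absurd (by rw [h1.2, h.src_arrow hτ]) h2
          · rfl
  | arr_tgt e =>
    cases j with
    | zero => simp [freeBandRep, arrEnd, vtxEnd]
    | succ j =>
      simp only [freeBandRep, arrEnd, vtxEnd, map_mul, FreeAlgebra.lift_ι_apply, Sum.elim_inl,
        Sum.elim_inr, unop_mul, unop_op, Module.End.mul_apply, LinearMap.coe_mk, AddHom.coe_mk]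
      by_cases h1 : vert (j + 1) = Q.tgt e
      · rw [if_pos h1]
      · have h2 : ¬ (j < n ∧ p j = e) := fun h2 => h1 (by rw [← h.tgt_eq j h2.1, h2.2])
        rw [if_neg h1, if_neg h2, zero_add]
        split_ifs with h3
        · by_cases hτ : τ = 0
          · simp [hτ]
          · exact absurd (by rw [h3.1, h3.2, h.tgt_arrow hτ]) h1
        · rfl

/-- The action of the path algebra underlying a representation of band type. -/
def pathBandRep (h : IsBandDatum k Q Rel n p vert a τ) :
    PathAlg k Q →ₐ[k] (Module.End k (ℕ → k))ᵐᵒᵖ :=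
  RingQuot.liftAlgHom k ⟨freeBandRep k Q n p vert a τ, h.freeBandRep_eq⟩

theorem pathBandRep_arr (h : IsBandDatum k Q Rel n p vert a τ) (e : Fin Q.nE) :
    pathBandRep h (arr k Q e) = op (arrEnd k Q n p a τ e) := by
  have h1 := RingQuot.liftAlgHom_mkAlgHom_apply k (freeBandRep k Q n p vert a τ)
    h.freeBandRep_eq (FreeAlgebra.ι k (Sum.inr e))
  refine Eq.trans h1 ?_
  simp [freeBandRep]

theorem pathBandRep_eq (h : IsBandDatum k Q Rel n p vert a τ) ⦃x y : PathAlg k Q⦄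
    (hxy : GRel k Q Rel x y) : pathBandRep h x = pathBandRep h y := by
  obtain ⟨⟨⟨e, f⟩, hef, rfl⟩, rfl⟩ := hxy
  rw [map_mul, pathBandRep_arr, pathBandRep_arr, map_zero, ← op_mul]
  apply unop_injective
  refine LinearMap.ext fun u => funext fun j => ?_
  rcases j with _ | _ | j
  · rfl
  · simp [arrEnd]
  · simp only [arrEnd, unop_op, Module.End.mul_apply, LinearMap.coe_mk, AddHom.coe_mk, mul_zero,
      ite_self, add_zero, unop_zero, LinearMap.zero_apply, Pi.zero_apply]
    split_ifs with h1 h2 h3 h3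
    · exact absurd hef (by rw [← h1.2, ← h2.2]; exact h.nonrel j h1.1)
    · exact absurd hef (by rw [← h1.2, ← h2.2]; exact h.nonrel j h1.1)
    · omega
    · simp
    · rfl

/-- The representation of `A` of band type. -/
def bandRep (h : IsBandDatum k Q Rel n p vert a τ) :
    GAlg k Q Rel →ₐ[k] (Module.End k (ℕ → k))ᵐᵒᵖ :=
  RingQuot.liftAlgHom k ⟨pathBandRep h, pathBandRep_eq h⟩

theorem bandRep_arrA (h : IsBandDatum k Q Rel n p vert a τ) (e : Fin Q.nE) :
    bandRep h (arrA k Q Rel e) = op (arrEnd k Q n p a τ e) :=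
  (RingQuot.liftAlgHom_mkAlgHom_apply k (pathBandRep h) (pathBandRep_eq h) (arr k Q e)).trans
    (pathBandRep_arr h e)

end Representations

section Words

variable (k : Type) [Field k] (Q : QuiverData) (Rel : Set (Fin Q.nE × Fin Q.nE))

/-- The product `s 0 * ⋯ * s (n - 1)` of arrows in `A`. -/
def word (s : ℕ → Fin Q.nE) : ℕ → GAlg k Q Rel
  | 0 => 1
  | n + 1 => word s n * arrA k Q Rel (s n)

variable {Q} in
/-- The first `n` terms of `s` are composable, and no two consecutive ones form a relation. -/
def IsNonrelPath (s : ℕ → Fin Q.nE) (n : ℕ) : Prop :=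
  ∀ i, i + 1 < n → Q.tgt (s i) = Q.src (s (i + 1)) ∧ (s i, s (i + 1)) ∉ Rel

variable {k Q Rel}

theorem word_congr {s s' : ℕ → Fin Q.nE} {n : ℕ} (h : ∀ i < n, s i = s' i) :
    word k Q Rel s n = word k Q Rel s' n := by
  induction n with
  | zero => rfl
  | succ n ih =>
    rw [word, word, ih fun i hi => h i (by omega), h n (by omega)]

theorem gmap_prod_ofFn (s : ℕ → Fin Q.nE) (n : ℕ) :
    gmap k Q Rel (List.ofFn fun i : Fin n => arr k Q (s i)).prod = word k Q Rel s n := by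
  induction n with
  | zero => simp [word]
  | succ n ih =>
    rw [List.ofFn_succ', List.concat_eq_append, List.prod_append, map_mul, word, ← ih]
    simp [arrA]

section BandAction

variable {n : ℕ} {p : ℕ → Fin Q.nE} {vert : ℕ → Fin Q.nV} {a : Fin Q.nE} {τ : k}

theorem bandRep_word_succ (h : IsBandDatum k Q Rel n p vert a τ) (s : ℕ → Fin Q.nE) (m : ℕ)
    (u : ℕ → k) :
    unop (bandRep h (word k Q Rel s (m + 1))) u =
      arrEnd k Q n p a τ (s m) (unop (bandRep h (word k Q Rel s m)) u) := by
  rw [word, map_mul, bandRep_arrA]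
  rfl

theorem bandRep_word_apply_of_lt (h : IsBandDatum k Q Rel n p vert a τ) (s : ℕ → Fin Q.nE)
    (m : ℕ) (u : ℕ → k) (j : ℕ) (hj : j < m) :
    unop (bandRep h (word k Q Rel s m)) u j = 0 := by
  induction m generalizing j with
  | zero => omega
  | succ m ih =>
    rw [bandRep_word_succ]
    cases j with
    | zero => rfl
    | succ j =>
      simp only [arrEnd, LinearMap.coe_mk, AddHom.coe_mk]
      rw [ih j (by omega), ih 0 (by omega)]
      simp

theorem bandRep_word_apply_of_gt (h : IsBandDatum k Q Rel n p vert a τ) (s : ℕ → Fin Q.nE)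
    (m : ℕ) (hm : 0 < m) (u : ℕ → k) (j : ℕ) (hj : n < j) :
    unop (bandRep h (word k Q Rel s m)) u j = 0 := by
  obtain ⟨m, rfl⟩ := Nat.exists_eq_succ_of_ne_zero hm.ne'
  obtain ⟨j, rfl⟩ := Nat.exists_eq_succ_of_ne_zero (show j ≠ 0 by omega)
  rw [Nat.succ_eq_add_one, bandRep_word_succ]
  simp only [arrEnd, LinearMap.coe_mk, AddHom.coe_mk]
  rw [if_neg (by omega), if_neg (by omega), add_zero]

theorem bandRep_word_apply_self (h : IsBandDatum k Q Rel n p vert a τ)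
    (hτ : τ = 0 ∨ p (n - 1) ≠ a) (m : ℕ) (hm : m ≤ n) (u : ℕ → k) :
    unop (bandRep h (word k Q Rel p m)) u m = u 0 := by
  induction m with
  | zero => simp [word]
  | succ m ih =>
    rw [bandRep_word_succ]
    simp only [arrEnd, LinearMap.coe_mk, AddHom.coe_mk]
    rw [if_pos ⟨by omega, trivial⟩, ih (by omega)]
    split_ifs with h1
    · rcases hτ with hτ | hτ
      · simp [hτ]
      · exact absurd h1.2 (by rw [show m = n - 1 by omega]; exact hτ)
    · simp

theorem bandRep_word (h : IsBandDatum k Q Rel n p vert a τ) (hn : 0 < n)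
    (hτ : τ = 0 ∨ p (n - 1) ≠ a) (u : ℕ → k) :
    unop (bandRep h (word k Q Rel p n)) u = Pi.single n (u 0) := by
  funext j
  rcases lt_trichotomy j n with hj | rfl | hj
  · rw [bandRep_word_apply_of_lt h p n u j hj, Pi.single_eq_of_ne hj.ne]
  · rw [bandRep_word_apply_self h hτ j le_rfl, Pi.single_eq_same]
  · rw [bandRep_word_apply_of_gt h p n hn u j hj, Pi.single_eq_of_ne hj.ne']

theorem bandRep_arrow_apply (h : IsBandDatum k Q Rel n p vert a τ) (hn : 0 < n)
    (ha : p (n - 1) ≠ a) (u : ℕ → k) :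
    unop (bandRep h (arrA k Q Rel a)) u n = τ * u 0 := by
  obtain ⟨n, rfl⟩ := Nat.exists_eq_succ_of_ne_zero hn.ne'
  rw [bandRep_arrA]
  simp only [Nat.succ_eq_add_one, Nat.add_sub_cancel] at ha
  simp [arrEnd, ha]

theorem bandRep_arrow_single (h : IsBandDatum k Q Rel n p vert a τ) (hn : 0 < n)
    (ha : p 0 ≠ a) :
    unop (bandRep h (arrA k Q Rel a)) (Pi.single 0 1) = Pi.single n τ := by
  obtain ⟨n, rfl⟩ := Nat.exists_eq_succ_of_ne_zero hn.ne'
  rw [bandRep_arrA]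
  funext j
  rcases j with _ | _ | j
  · simp [arrEnd]
  · by_cases hn0 : 0 = n
    · simp [arrEnd, ha, ← hn0]
    · simp [arrEnd, ha, hn0, Ne.symm hn0]
  · by_cases hn0 : j + 1 = n
    · simp [arrEnd, ← hn0]
    · simp [arrEnd, hn0]

end BandAction

theorem IsNonrelPath.isBandDatum {s : ℕ → Fin Q.nE} {n : ℕ} (hs : IsNonrelPath Rel s n)
    (hn : 0 < n) (a : Fin Q.nE) :
    IsBandDatum k Q Rel n s
      (fun i => if i < n then Q.src (s i) else Q.tgt (s (n - 1))) a (0 : k) where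
  src_eq i hi := by simp [hi]
  tgt_eq i hi := by
    by_cases h : i + 1 < n
    · simp [h, (hs i h).1]
    · obtain rfl : i = n - 1 := by omega
      simp [h]
  nonrel i hi := (hs i hi).2
  src_arrow h := absurd rfl h
  tgt_arrow h := absurd rfl h

theorem IsNonrelPath.word_ne_zero {s : ℕ → Fin Q.nE} {n : ℕ} (hs : IsNonrelPath Rel s n)
    (hn : 0 < n) : word k Q Rel s n ≠ 0 := by
  intro h0
  have h := bandRep_word (hs.isBandDatum (k := k) hn (s 0)) hn (Or.inl rfl) (Pi.single 0 1)
  rw [h0, map_zero] at h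
  have := congrFun h n
  simp at this

theorem not_inI_of_notMem {e f : Fin Q.nE} (hc : Q.tgt e = Q.src f) (hr : (e, f) ∉ Rel) :
    ¬ inI k Q Rel (arr k Q e * arr k Q f) := by
  intro h
  have hs : IsNonrelPath Rel (fun i => if i = 0 then e else f) 2 := by
    intro i hi
    obtain rfl : i = 0 := by omega
    exact ⟨hc, hr⟩
  refine hs.word_ne_zero (k := k) (by norm_num) ?_
  rw [inI, map_mul] at h
  simpa [word, arrA] using h

theorem vtx_mul_vtx (v w : Fin Q.nV) : vtx k Q v * vtx k Q w = if v = w then vtx k Q v else 0 := by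
  have h := (map_mul (RingQuot.mkAlgHom k (PathRel k Q)) _ _).symm.trans
    (RingQuot.mkAlgHom_rel k (PathRel.vtx_mul (k := k) v w))
  split_ifs with hvw
  · rwa [if_pos hvw] at h
  · rw [if_neg hvw, map_zero] at h
    exact h

theorem vtx_src_mul_arr (e : Fin Q.nE) : vtx k Q (Q.src e) * arr k Q e = arr k Q e :=
  (map_mul (RingQuot.mkAlgHom k (PathRel k Q)) _ _).symm.trans
    (RingQuot.mkAlgHom_rel k (PathRel.src_arr (k := k) e))

theorem arr_mul_vtx_tgt (e : Fin Q.nE) : arr k Q e * vtx k Q (Q.tgt e) = arr k Q e :=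
  (map_mul (RingQuot.mkAlgHom k (PathRel k Q)) _ _).symm.trans
    (RingQuot.mkAlgHom_rel k (PathRel.arr_tgt (k := k) e))

theorem arr_mul_vtx (e : Fin Q.nE) (v : Fin Q.nV) :
    arr k Q e * vtx k Q v = if Q.tgt e = v then arr k Q e else 0 := by
  rw [← arr_mul_vtx_tgt, mul_assoc, vtx_mul_vtx]
  split_ifs <;> simp

theorem arrA_mul_vtxA (e : Fin Q.nE) (v : Fin Q.nV) :
    arrA k Q Rel e * vtxA k Q Rel v = if Q.tgt e = v then arrA k Q Rel e else 0 := by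
  rw [arrA, vtxA, ← map_mul, arr_mul_vtx]
  split_ifs <;> simp

theorem arrA_mul_arrA_eq_zero {e f : Fin Q.nE} (h : Q.tgt e = Q.src f → (e, f) ∈ Rel) :
    arrA k Q Rel e * arrA k Q Rel f = 0 := by
  rw [arrA, arrA, ← map_mul]
  by_cases hc : Q.tgt e = Q.src f
  · have h1 : GRel k Q Rel (arr k Q e * arr k Q f) 0 := ⟨⟨(e, f), h hc, rfl⟩, rfl⟩
    exact (RingQuot.mkAlgHom_rel k h1).trans (map_zero (gmap k Q Rel))
  · rw [← vtx_src_mul_arr f, ← mul_assoc, arr_mul_vtx, if_neg hc, zero_mul, map_zero]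

theorem GAlg.induction {motive : GAlg k Q Rel → Prop}
    (algebraMap : ∀ c : k, motive (algebraMap k _ c))
    (vtx : ∀ v, motive (vtxA k Q Rel v)) (arr : ∀ e, motive (arrA k Q Rel e))
    (mul : ∀ x y, motive x → motive y → motive (x * y))
    (add : ∀ x y, motive x → motive y → motive (x + y)) (x : GAlg k Q Rel) : motive x := by
  obtain ⟨x, rfl⟩ := RingQuot.mkAlgHom_surjective k (GRel k Q Rel) x
  obtain ⟨x, rfl⟩ := RingQuot.mkAlgHom_surjective k (PathRel k Q) x
  change motive (gmap k Q Rel (RingQuot.mkAlgHom k (PathRel k Q) x))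
  induction x using FreeAlgebra.induction with
  | grade0 c =>
    rw [AlgHom.commutes]
    exact ((gmap k Q Rel).commutes c).symm ▸ algebraMap c
  | grade1 x =>
    rcases x with v | e
    · exact vtx v
    · exact arr e
  | mul x y hx hy =>
    rw [map_mul]
    exact (map_mul (gmap k Q Rel) _ _).symm ▸ mul _ _ hx hy
  | add x y hx hy =>
    rw [map_add]
    exact (map_add (gmap k Q Rel) _ _).symm ▸ add _ _ hx hy

theorem word_succ_mul_vtxA (s : ℕ → Fin Q.nE) (n : ℕ) (v : Fin Q.nV) :
    word k Q Rel s (n + 1) * vtxA k Q Rel v =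
      if Q.tgt (s n) = v then word k Q Rel s (n + 1) else 0 := by
  rw [word, mul_assoc, arrA_mul_vtxA]
  split_ifs <;> simp

variable (k Q Rel) in
/-- The subspace of `A` spanned by the paths that start with the arrow `b`. -/
def pathSpan (b : Fin Q.nE) : Submodule k (GAlg k Q Rel) :=
  Submodule.span k {w | ∃ s n, IsNonrelPath Rel s (n + 1) ∧ s 0 = b ∧ w = word k Q Rel s (n + 1)}

theorem mul_mem_pathSpan (b : Fin Q.nE) (x : GAlg k Q Rel) :
    ∀ m ∈ pathSpan k Q Rel b, m * x ∈ pathSpan k Q Rel b := by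
  induction x using GAlg.induction with
  | algebraMap c =>
    intro m hm
    rw [← Algebra.commutes, ← Algebra.smul_def]
    exact Submodule.smul_mem _ _ hm
  | vtx v =>
    change pathSpan k Q Rel b ≤ (pathSpan k Q Rel b).comap (LinearMap.mulRight k (vtxA k Q Rel v))
    refine Submodule.span_le.2 ?_
    rintro _ ⟨s, n, hs, h0, rfl⟩
    rw [SetLike.mem_coe, Submodule.mem_comap, LinearMap.mulRight_apply, word_succ_mul_vtxA]
    split_ifs
    · exact Submodule.subset_span ⟨s, n, hs, h0, rfl⟩
    · exact zero_mem _
  | arr e =>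
    change pathSpan k Q Rel b ≤ (pathSpan k Q Rel b).comap (LinearMap.mulRight k (arrA k Q Rel e))
    refine Submodule.span_le.2 ?_
    rintro _ ⟨s, n, hs, h0, rfl⟩
    rw [SetLike.mem_coe, Submodule.mem_comap, LinearMap.mulRight_apply]
    by_cases h : Q.tgt (s n) = Q.src e ∧ (s n, e) ∉ Rel
    · have hlt : ∀ i < n + 1, Function.update s (n + 1) e i = s i := fun i hi =>
        Function.update_of_ne hi.ne _ _
      refine Submodule.subset_span ⟨Function.update s (n + 1) e, n + 1, ?_, ?_, ?_⟩
      · intro i hi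
        rw [hlt i (by omega)]
        by_cases hin : i = n
        · subst hin
          simpa using h
        · rw [hlt (i + 1) (by omega)]
          exact hs i (by omega)
      · rw [hlt 0 (by omega), h0]
      · rw [word.eq_def _ _ _ _ (n + 1 + 1)]
        simp only
        rw [word_congr hlt, Function.update_self]
    · rw [word, mul_assoc, arrA_mul_arrA_eq_zero (by tauto), mul_zero]
      exact zero_mem _
  | mul x y hx hy =>
    intro m hm
    rw [← mul_assoc]
    exact hy _ (hx m hm)
  | add x y hx hy =>
    intro m hm
    rw [mul_add]
    exact add_mem (hx m hm) (hy m hm)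

theorem arrA_mul_mul_vtxA_mem_span (b : Fin Q.nE) (x : GAlg k Q Rel) (v : Fin Q.nV) :
    arrA k Q Rel b * x * vtxA k Q Rel v ∈ Submodule.span k {w | ∃ s n,
      IsNonrelPath Rel s (n + 1) ∧ s 0 = b ∧ Q.tgt (s n) = v ∧ w = word k Q Rel s (n + 1)} := by
  have hb : arrA k Q Rel b ∈ pathSpan k Q Rel b :=
    Submodule.subset_span ⟨fun _ => b, 0, fun i hi => by omega, rfl, by simp [word]⟩
  have hmem := mul_mem_pathSpan b x _ hb
  generalize arrA k Q Rel b * x = y at hmem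
  induction hmem using Submodule.span_induction with
  | mem y hy =>
    obtain ⟨s, n, hs, h0, rfl⟩ := hy
    rw [word_succ_mul_vtxA]
    split_ifs with h
    · exact Submodule.subset_span ⟨s, n, hs, h0, h, rfl⟩
    · exact zero_mem _
  | zero => simp
  | add y z _ _ hy hz => rw [add_mul]; exact add_mem hy hz
  | smul c y _ hy => rw [smul_mul_assoc]; exact Submodule.smul_mem _ _ hy

end Words

section Gentle

variable {k : Type} [Field k] {Q : QuiverData} {Rel : Set (Fin Q.nE × Fin Q.nE)}

theorem IsGentle.eq_of_isNonrelPath (hg : IsGentle k Q Rel) {s s' : ℕ → Fin Q.nE} {n n' : ℕ}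
    (hs : IsNonrelPath Rel s n) (hs' : IsNonrelPath Rel s' n') (h0 : s 0 = s' 0) (i : ℕ)
    (hi : i < n) (hi' : i < n') : s i = s' i := by
  induction i with
  | zero => exact h0
  | succ i ih =>
    have hi1 := hs i hi
    have hi1' := hs' i hi'
    rw [← ih (by omega) (by omega)] at hi1'
    exact hg.uniq_nonrel_right _ _ _ (not_inI_of_notMem hi1.1 hi1.2)
      (not_inI_of_notMem hi1'.1 hi1'.2)

/-- A nonzero path in a gentle algebra does not contain the same arrow twice. -/
theorem IsGentle.ne_of_isNonrelPath (hg : IsGentle k Q Rel) {s : ℕ → Fin Q.nE} {n : ℕ}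
    (hs : IsNonrelPath Rel s n) {i j : ℕ} (hij : i < j) (hj : j < n) : s i ≠ s j := by
  intro heq
  obtain ⟨m, hm, hadm⟩ := hg.admissible
  have hs' : IsNonrelPath Rel (fun r => s (i + r % (j - i))) m := by
    intro r _
    have hlt : r % (j - i) < j - i := Nat.mod_lt _ (by omega)
    by_cases h : r % (j - i) + 1 < j - i
    · have h1 : (r + 1) % (j - i) = r % (j - i) + 1 := by
        rw [Nat.add_mod_eq_ite, Nat.mod_eq_of_lt (show 1 < j - i by omega), if_neg (by omega)]
      dsimp only
      rw [h1]
      exact hs _ (by omega)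
    · have h1 : (r + 1) % (j - i) = 0 := by
        rw [← Nat.mod_add_mod, show r % (j - i) + 1 = j - i by omega, Nat.mod_self]
      dsimp only
      rw [h1, add_zero, heq]
      have h2 := hs (i + r % (j - i)) (by omega)
      rwa [show i + r % (j - i) + 1 = j by omega] at h2
  refine hs'.word_ne_zero (k := k) (by omega) ?_
  rw [← gmap_prod_ofFn]
  exact hadm fun r => s (i + r % (j - i))

end Gentle

/-- If a family of finitely generated modules, indexed by an infinite type, is separated by the
solvability of the conditions `p • v ≠ 0` and `a • v = b τ • v`, then there are infinitely many
indecomposable modules: each member has an indecomposable submodule with a solution. -/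
theorem not_repFinite_of_family {S : Type} [Ring S] [IsArtinianRing S] {κ : Type} [Infinite κ]
    (p a : S) (b : κ → S) (M : κ → ModuleCat.{0} S) (hfin : ∀ τ, Module.Finite S (M τ))
    (hex : ∀ τ, ∃ v : M τ, p • v ≠ 0 ∧ a • v = b τ • v)
    (huniq : ∀ τ σ, (∃ v : M σ, p • v ≠ 0 ∧ a • v = b τ • v) → τ = σ) : ¬ RepFinite S := by
  rintro ⟨n, L, hL⟩
  have key : ∀ τ, ∃ X : Submodule S (M τ),
      IsIndec S X ∧ ∃ v ∈ X, p • v ≠ 0 ∧ a • v = b τ • v := by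
    intro τ
    have := hfin τ
    obtain ⟨v₀, hv₀⟩ := hex τ
    obtain ⟨X, ⟨v, hvX, hv1, hv2⟩, hmin⟩ := (wellFounded_lt (α := Submodule S (M τ))).has_min
      {X | ∃ v ∈ X, p • v ≠ 0 ∧ a • v = b τ • v} ⟨⊤, v₀, Submodule.mem_top, hv₀⟩
    refine ⟨X, ⟨?_, ?_⟩, v, hvX, hv1, hv2⟩
    · refine ⟨⟨v, hvX⟩, 0, fun h => hv1 ?_⟩
      rw [show v = 0 from congrArg Subtype.val h, smul_zero]
    · intro N₁ N₂ hN
      have hzero : ∀ N N' : Submodule S X, IsCompl N N' → ∀ w ∈ N, w ∈ N' → w = 0 :=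
        fun N N' h w hw hw' => (Submodule.disjoint_def.1 h.disjoint) w hw hw'
      have hpart : ∀ N N' : Submodule S X, IsCompl N N' → N' ≠ ⊥ → ∀ w ∈ N,
          a • w = b τ • w → p • w = 0 := by
        intro N N' hc hN' w hw hwa
        by_contra hwp
        refine hmin (N.map X.subtype) ⟨w, ⟨w, hw, rfl⟩, ?_, ?_⟩ ?_
        · exact fun h => hwp (Subtype.ext h)
        · exact congrArg Subtype.val hwa
        · refine lt_of_le_of_ne (Submodule.map_subtype_le X N) fun heq => hN' ?_
          have htop : N = ⊤ := by
            refine eq_top_iff.2 fun z _ => ?_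
            have hz : (z : M τ) ∈ N.map X.subtype := heq.symm ▸ z.2
            obtain ⟨z', hz', hzz⟩ := hz
            rwa [← Subtype.ext (a1 := z') (a2 := z) hzz]
          rw [htop] at hc
          exact disjoint_top.1 hc.disjoint.symm
      by_contra! hne
      obtain ⟨x, hx, y, hy, hxy⟩ := Submodule.mem_sup.1
        (hN.sup_eq_top ▸ Submodule.mem_top : (⟨v, hvX⟩ : X) ∈ N₁ ⊔ N₂)
      have hsum : (a • x - b τ • x) + (a • y - b τ • y) = 0 := by
        have h1 : a • (x + y) = b τ • (x + y) := by
          rw [hxy]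
          exact Subtype.ext hv2
        rw [smul_add, smul_add] at h1
        rw [← add_sub_add_comm, h1, sub_self]
      have hx1 : a • x - b τ • x ∈ N₁ := sub_mem (N₁.smul_mem _ hx) (N₁.smul_mem _ hx)
      have hy1 : a • y - b τ • y ∈ N₂ := sub_mem (N₂.smul_mem _ hy) (N₂.smul_mem _ hy)
      have hx0 : a • x - b τ • x = 0 := by
        refine hzero N₁ N₂ hN _ hx1 ?_
        rw [eq_neg_of_add_eq_zero_left hsum]
        exact neg_mem hy1
      have hy0 : a • y - b τ • y = 0 := by rwa [hx0, zero_add] at hsum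
      refine hv1 ?_
      have h3 : p • (⟨v, hvX⟩ : X) = 0 := by
        rw [← hxy, smul_add, hpart N₁ N₂ hN hne.2 x hx (sub_eq_zero.1 hx0),
          hpart N₂ N₁ hN.symm hne.1 y hy (sub_eq_zero.1 hy0), add_zero]
      exact congrArg Subtype.val h3
  choose X hX v hvX hv1 hv2 using key
  have hiso : ∀ τ, ∃ i, Nonempty (X τ ≃ₗ[S] L i) := fun τ =>
    have := hfin τ
    hL (ModuleCat.of S (X τ)) (inferInstanceAs (Module.Finite S (X τ))) (hX τ)
  choose f hf using hiso
  obtain ⟨τ, σ, hne, hfe⟩ := Finite.exists_ne_map_eq_of_infinite f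
  obtain ⟨e₁⟩ := hf τ
  obtain ⟨e₂⟩ := hf σ
  rw [← hfe] at e₂
  let φ := e₁.trans e₂.symm
  refine hne (huniq τ σ ⟨φ ⟨v τ, hvX τ⟩, fun h => hv1 τ ?_, ?_⟩)
  · have h1 : φ (p • ⟨v τ, hvX τ⟩) = 0 := by
      rw [map_smul]
      exact Subtype.ext h
    exact congrArg Subtype.val (φ.map_eq_zero_iff.1 h1)
  · have h1 : a • (⟨v τ, hvX τ⟩ : X τ) = b τ • ⟨v τ, hvX τ⟩ := Subtype.ext (hv2 τ)
    have h2 := congrArg φ h1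
    rw [map_smul, map_smul] at h2
    exact congrArg Subtype.val h2

section Band

variable {k : Type} [Field k] {Q : QuiverData} {Rel : Set (Fin Q.nE × Fin Q.nE)}
  {n : ℕ} {p : ℕ → Fin Q.nE} {vert : ℕ → Fin Q.nV} {a : Fin Q.nE} {τ : k}

/-- The right `A`-module of sequences given by `bandRep`. -/
def BandSeq (_ : IsBandDatum k Q Rel n p vert a τ) : Type := ℕ → k

instance (h : IsBandDatum k Q Rel n p vert a τ) : AddCommGroup (BandSeq h) :=
  inferInstanceAs (AddCommGroup (ℕ → k))

instance (h : IsBandDatum k Q Rel n p vert a τ) : Module (GAlg k Q Rel)ᵐᵒᵖ (BandSeq h) :=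
  Module.compHom (ℕ → k) (AlgHom.opComm (bandRep h)).toRingHom

/-- The sequence supported at position `0`. -/
def BandSeq.gen (h : IsBandDatum k Q Rel n p vert a τ) : BandSeq h :=
  (Pi.single 0 1 : ℕ → k)

/-- The submodule generated by the sequence supported at position `0`. -/
abbrev bandModule (h : IsBandDatum k Q Rel n p vert a τ) :
    Submodule (GAlg k Q Rel)ᵐᵒᵖ (BandSeq h) :=
  Submodule.span (GAlg k Q Rel)ᵐᵒᵖ {BandSeq.gen h}

/-- A nonzero path parallel to an arrow `a`, which neither starts nor ends with `a`, yields a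
one-parameter family of band modules. -/
theorem not_repFinite_of_parallel [Infinite k] [Module.Finite k (GAlg k Q Rel)]
    (h : ∀ τ : k, IsBandDatum k Q Rel n p vert a τ) (hn : 0 < n) (hfst : p 0 ≠ a)
    (hlst : p (n - 1) ≠ a) : ¬ RepFinite (GAlg k Q Rel)ᵐᵒᵖ := by
  have : IsArtinianRing (GAlg k Q Rel)ᵐᵒᵖ := IsArtinianRing.of_finite k _
  refine not_repFinite_of_family (κ := k) (op (word k Q Rel p n)) (op (arrA k Q Rel a))
    (fun τ => op (τ • word k Q Rel p n)) (fun τ => ModuleCat.of _ (bandModule (h τ))) ?_ ?_ ?_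
  · exact fun τ => inferInstanceAs (Module.Finite _ (bandModule (h τ)))
  · intro τ
    have h1 : unop (bandRep (h τ) (word k Q Rel p n)) (Pi.single 0 1) ≠ 0 := by
      rw [bandRep_word (h τ) hn (Or.inr hlst)]
      simp
    have h2 : unop (bandRep (h τ) (arrA k Q Rel a)) (Pi.single 0 1) =
        unop (bandRep (h τ) (τ • word k Q Rel p n)) (Pi.single 0 1) := by
      rw [bandRep_arrow_single (h τ) hn hfst, map_smul, unop_smul, LinearMap.smul_apply,
        bandRep_word (h τ) hn (Or.inr hlst)]
      funext j
      simp [Pi.single_apply]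
    exact ⟨(⟨BandSeq.gen (h τ), Submodule.mem_span_singleton_self _⟩ : bandModule (h τ)),
      fun h0 => h1 (congrArg Subtype.val h0), Subtype.ext h2⟩
  · intro τ σ
    have hsep : ∀ u : ℕ → k, unop (bandRep (h σ) (word k Q Rel p n)) u ≠ 0 →
        unop (bandRep (h σ) (arrA k Q Rel a)) u =
          unop (bandRep (h σ) (τ • word k Q Rel p n)) u → τ = σ := by
      intro u h1 h2
      rw [bandRep_word (h σ) hn (Or.inr hlst)] at h1
      rw [map_smul, unop_smul, LinearMap.smul_apply, bandRep_word (h σ) hn (Or.inr hlst)] at h2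
      have h3 := congrFun h2 n
      rw [bandRep_arrow_apply (h σ) hn hlst] at h3
      have hu0 : u 0 ≠ 0 := fun h0 => h1 (by rw [h0, Pi.single_zero])
      refine (mul_right_cancel₀ hu0 ?_).symm
      simpa using h3
    rintro ⟨(v : bandModule (h σ)), hv1, hv2⟩
    exact hsep v.1 (fun h0 => hv1 (Subtype.ext h0)) (congrArg Subtype.val hv2)

end Band

theorem FRCycle.src_ne_src_succ {k : Type} [Field k] {Q : QuiverData}
    {Rel : Set (Fin Q.nE × Fin Q.nE)} (C : FRCycle k Q Rel) (i : ℕ) :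
    Q.src (C.arrows i) ≠ Q.src (C.arrows (i + 1)) := by
  intro h
  have hmod : ∀ j, C.arrows (j % C.len) = C.arrows j :=
    Function.Periodic.map_mod_nat C.periodic
  have hlen := C.len3
  rw [← hmod i, ← hmod (i + 1)] at h
  have h1 := C.vinj _ _ (Nat.mod_lt _ (by omega)) (Nat.mod_lt _ (by omega)) h
  rw [Nat.add_mod_eq_ite, Nat.mod_eq_of_lt (show 1 < C.len by omega)] at h1
  have := Nat.mod_lt i (show 0 < C.len by omega)
  split_ifs at h1 <;> omega

/-- A space spanned by words that has dimension at least two contains two different words, hence,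
by gentleness, a path and a proper initial subpath. -/
theorem IsGentle.exists_path_of_one_lt_finrank {k : Type} [Field k] {Q : QuiverData}
    {Rel : Set (Fin Q.nE × Fin Q.nE)} (hg : IsGentle k Q Rel) [Module.Finite k (GAlg k Q Rel)]
    (b : Fin Q.nE) (v : Fin Q.nV)
    (hdim : 1 < Module.finrank k ↥(Submodule.span k {y : GAlg k Q Rel |
      ∃ x, y = arrA k Q Rel b * x * vtxA k Q Rel v})) :
    ∃ s m n, m < n ∧ IsNonrelPath Rel s (n + 1) ∧ s 0 = b ∧ Q.tgt (s m) = v ∧ Q.tgt (s n) = v := by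
  by_contra! hcon
  let W : Set (GAlg k Q Rel) := {w | ∃ s n,
      IsNonrelPath Rel s (n + 1) ∧ s 0 = b ∧ Q.tgt (s n) = v ∧ w = word k Q Rel s (n + 1)}
  have hle : Submodule.span k {y : GAlg k Q Rel | ∃ x, y = arrA k Q Rel b * x * vtxA k Q Rel v} ≤
      Submodule.span k W := by
    refine Submodule.span_le.2 ?_
    rintro _ ⟨x, rfl⟩
    exact arrA_mul_mul_vtxA_mem_span b x v
  have hsub : W.Subsingleton := by
    rintro _ ⟨s, n, hs, hs0, hsn, rfl⟩ _ ⟨s', n', hs', hs0', hsn', rfl⟩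
    have heq := hg.eq_of_isNonrelPath hs hs' (hs0.trans hs0'.symm)
    rcases lt_trichotomy n n' with hlt | rfl | hlt
    · exact absurd hsn' (hcon s' n n' hlt hs' hs0' (by rw [← heq n (by omega) (by omega), hsn]))
    · exact word_congr fun i hi => heq i hi hi
    · exact absurd hsn (hcon s n' n hlt hs hs0 (by rw [heq n' (by omega) (by omega), hsn']))
  have hrank := Submodule.finrank_mono hle
  rcases hsub.eq_empty_or_singleton with h | ⟨w, h⟩
  · rw [h, Submodule.span_empty, finrank_bot] at hrank
    omega
  · rw [h] at hrank
    have hw := finrank_span_le_card (R := k) {w}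
    simp only [Set.toFinset_singleton, Finset.card_singleton] at hw
    omega

/-- Lemma `lemm:cycle` (2).  Let `A = kQ/I` be gentle with a
full-relational oriented cycle `𝒞 = a_1 ⋯ a_l`.  If `dim_k (a_t A ε_{t+2}) > 1`
for some `t < l` (with `ε_{t+2}` the trivial-path idempotent at the vertex
`t(a_{t+1})`, and `a_t A ε_{t+2}` the `k`-subspace of `A` of all elements
`a_t · x · ε_{t+2}`), then `A` is representation-infinite. -/
theorem stmt6 (k : Type) [Field k] [IsAlgClosed k] (Q : QuiverData)
    (Rel : Set (Fin Q.nE × Fin Q.nE)) (hgentle : IsGentle k Q Rel)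
    (hfd : Module.Finite k (GAlg k Q Rel)) (hns : NoShortFRC k Q Rel)
    (C : FRCycle k Q Rel) (t : ℕ) (ht : t < C.len)
    (hdim : 1 < Module.finrank k ↥(Submodule.span k {y : GAlg k Q Rel |
      ∃ x, y = arrA k Q Rel (C.arrows t) * x *
        vtxA k Q Rel (Q.tgt (C.arrows (t + 1)))})) :
    ¬ RepFinite (GAlg k Q Rel)ᵐᵒᵖ := by
  have : Infinite k := IsAlgClosed.instInfinite
  obtain ⟨s, m, n, hmn, hs, hs0, hsm, hsn⟩ := hgentle.exists_path_of_one_lt_finrank _ _ hdim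
  have hne := hgentle.ne_of_isNonrelPath hs hmn (by omega)
  obtain ⟨N, hN, hsN, hNa⟩ : ∃ N ≤ n, Q.tgt (s N) = Q.tgt (C.arrows (t + 1)) ∧
      s N ≠ C.arrows (t + 1) := by
    by_cases h : s m = C.arrows (t + 1)
    · exact ⟨n, le_rfl, hsn, fun h' => hne (h.trans h'.symm)⟩
    · exact ⟨m, hmn.le, hsm, h⟩
  have hN0 : 0 < N := by
    refine Nat.pos_of_ne_zero ?_
    rintro rfl
    rw [hs0, C.comp, C.comp] at hsN
    exact C.src_ne_src_succ _ hsN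
  have hs1 : s 1 ≠ C.arrows (t + 1) := by
    intro h
    have h01 := hs 0 (by omega)
    refine not_inI_of_notMem (k := k) h01.1 h01.2 ?_
    rw [zero_add, hs0, h]
    exact C.frel t
  refine not_repFinite_of_parallel (n := N) (p := fun i => s (i + 1))
    (vert := fun i => Q.tgt (s i)) (a := C.arrows (t + 1)) (fun τ => ?_) hN0 hs1 ?_
  · exact {
      src_eq := fun i hi => (hs i (by omega)).1.symm
      tgt_eq := fun i _ => rfl
      nonrel := fun i hi => (hs (i + 1) (by omega)).2
      src_arrow := fun _ => by rw [hs0, C.comp]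
      tgt_arrow := fun _ => hsN.symm }
  · simpa [Nat.sub_add_cancel hN0] using hNa
end
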